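/- If a multi-robot system is weakly fault tolerant, then every task j ∈ L that lies in the capability set of at least one robot satisfies |{h ∈ R : j ∈ 𝓛(h)}| ≥ a(j) + 1. -/

import Mathlib

/-- An assignment of a multi-robot system with robots `ι`, tasks `τ`,
capability sets `cap`, and bounds `a`, `b`: a `{0,1}`-valued function
`r` such that robots are only assigned tasks they are capable of,
each robot gets at most one task, and each task `j` is assigned to
between `a j` and `b j` robots. -/
def IsAssignment {ι τ : Type*} [Fintype ι] [Fintype τ]
    (cap : ι → Finset τ) (a b : τ → ℕ) (r : ι → τ → ℕ) : Prop :=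
  (∀ i j, r i j ≤ 1) ∧
  (∀ i j, r i j = 1 → j ∈ cap i) ∧
  (∀ i, ∑ j, r i j ≤ 1) ∧
  (∀ j, a j ≤ ∑ i, r i j ∧ ∑ i, r i j ≤ b j)

/-- A multi-robot system is consistent if an assignment exists. -/
def Consistent {ι τ : Type*} [Fintype ι] [Fintype τ]
    (cap : ι → Finset τ) (a b : τ → ℕ) : Prop :=
  ∃ r, IsAssignment cap a b r

/-- In a weakly fault tolerant system, every task lying in the capability set
of at least one robot is in the capability sets of at least `a j + 1`
robots. -/
theorem card_capable_of_weakly_fault_tolerant {ι τ : Type*} [Fintype ι] [Fintype τ]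
    [DecidableEq ι] [DecidableEq τ]
    (cap : ι → Finset τ) (a b : τ → ℕ) (hab : ∀ j, a j ≤ b j)
    (hwft : ∀ i : ι, ∀ j ∈ cap i,
        Consistent (Function.update cap i (cap i \ {j})) a b) :
    ∀ j : τ, (∃ i : ι, j ∈ cap i) →
      a j + 1 ≤ (Finset.univ.filter (fun h : ι => j ∈ cap h)).card := by
  rintro j ⟨i, hi⟩
  obtain ⟨r, hle, hcap, -, hbd⟩ := hwft i j hi
  have hsum : ∑ h, r h j ≤ ((Finset.univ.filter (fun h : ι => j ∈ cap h)).erase i).card := by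
    rw [Finset.card_eq_sum_ones, ← Finset.sum_subset (Finset.subset_univ
      ((Finset.univ.filter (fun h : ι => j ∈ cap h)).erase i))]
    · exact Finset.sum_le_sum fun h _ => hle h j
    · intro h _ hh
      by_contra hne
      have hmem := hcap h j (by have := hle h j; omega)
      by_cases hhi : h = i
      · subst hhi
        simp at hmem
      · rw [Function.update_of_ne hhi] at hmem
        exact hh (by simp [hhi, hmem])
  have hi' : i ∈ Finset.univ.filter (fun h : ι => j ∈ cap h) := by simpa using hi
  rw [← Finset.card_erase_add_one hi']
  exact Nat.add_le_add_right ((hbd j).1.trans hsum) 1
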